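/- Estimation of Q (two-sided bound): Let γ be C², 2π-periodic, positive, and satisfy 3γ(θ) − γ(θ−π) ≥ 0 for all θ. Define A(θ) = (π²/8)(5·sup|γ''| + 5|γ'(θ)| + γ(θ)), P_α(φ,θ) = γ(θ) − γ'(θ)sin 2φ + α sin²φ, and Q(φ,θ) = γ(θ−φ) + γ(θ)cos φ − γ'(θ)sin φ. Then |Q(φ,θ)| ≤ |P_{A(θ)}(φ,θ) + γ(θ)| for all φ, θ. -/

import Mathlib

noncomputable def Lmat (θ : ℝ) : Matrix (Fin 2) (Fin 2) ℝ :=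
  !![-Real.sin (2 * θ), Real.cos (2 * θ); Real.cos (2 * θ), Real.sin (2 * θ)]

noncomputable def nvec (θ : ℝ) : Fin 2 → ℝ := ![-Real.sin θ, Real.cos θ]

noncomputable def tvec (θ : ℝ) : Fin 2 → ℝ := ![Real.cos θ, Real.sin θ]

noncomputable def Zhat (γ k : ℝ → ℝ) (θ : ℝ) : Matrix (Fin 2) (Fin 2) ℝ :=
  γ θ • (1 : Matrix (Fin 2) (Fin 2) ℝ) + deriv γ θ • Lmat θ +
    k θ • Matrix.vecMulVec (nvec θ) (nvec θ)

noncomputable def Pfun (γ : ℝ → ℝ) (α φ θ : ℝ) : ℝ :=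
  γ θ - deriv γ θ * Real.sin (2 * φ) + α * Real.sin φ ^ 2

noncomputable def Qfun (γ : ℝ → ℝ) (φ θ : ℝ) : ℝ :=
  γ (θ - φ) + γ θ * Real.cos φ - deriv γ θ * Real.sin φ

noncomputable def Afun (γ : ℝ → ℝ) (θ : ℝ) : ℝ :=
  Real.pi ^ 2 / 8 *
    (5 * (⨆ x, |deriv (deriv γ) x|) + 5 * |deriv γ θ| + γ θ)

lemma aux_taylor (γ : ℝ → ℝ) (hγ : ContDiff ℝ 2 γ) (M : ℝ)
    (hM : ∀ x, |deriv (deriv γ) x| ≤ M) (θ t : ℝ) :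
    γ (θ + t) ≤ γ θ + deriv γ θ * t + M * t ^ 2 / 2 := by
  have h1 : Differentiable ℝ γ := hγ.differentiable (by norm_num)
  have h2 : Differentiable ℝ (deriv γ) := by
    have : ContDiff ℝ 1 (deriv γ) := by
      have h := (contDiff_succ_iff_deriv (n := 1) (f := γ) (𝕜 := ℝ)).1 (by simpa [one_add_one_eq_two] using hγ)
      exact h.2.2
    exact this.differentiable (by norm_num)
  have hd : ∀ x, HasDerivAt (fun x => M * x ^ 2 / 2 - γ x) (M * x - deriv γ x) x := by
    intro x
    have := (((hasDerivAt_pow 2 x).const_mul M).div_const 2).sub (h1 x).hasDerivAt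
    exact this.congr_deriv (by push_cast; ring)
  have hd2 : ∀ x, HasDerivAt (fun x => M * x - deriv γ x) (M - deriv (deriv γ) x) x := by
    intro x
    have := ((hasDerivAt_id x).const_mul M).sub (h2 x).hasDerivAt
    exact this.congr_deriv (by ring)
  have hmono : Monotone (fun x => M * x - deriv γ x) := by
    apply monotone_of_deriv_nonneg (fun x => (hd2 x).differentiableAt)
    intro x
    rw [(hd2 x).deriv]
    linarith [le_abs_self (deriv (deriv γ) x), hM x]
  have hconv : ConvexOn ℝ Set.univ (fun x => M * x ^ 2 / 2 - γ x) := by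
    apply Monotone.convexOn_univ_of_deriv (fun x => (hd x).differentiableAt)
    have : deriv (fun x => M * x ^ 2 / 2 - γ x) = fun x => M * x - deriv γ x :=
      funext fun x => (hd x).deriv
    rw [this]; exact hmono
  rcases lt_trichotomy t 0 with ht | ht | ht
  · have := hconv.slope_le_of_hasDerivAt (Set.mem_univ (θ + t)) (Set.mem_univ θ) (by linarith) (hd θ)
    rw [slope_def_field, div_le_iff₀ (by linarith)] at this
    nlinarith
  · subst ht; simp
  · have := hconv.le_slope_of_hasDerivAt (Set.mem_univ θ) (Set.mem_univ (θ + t)) (by linarith) (hd θ)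
    rw [slope_def_field, le_div_iff₀ (by linarith)] at this
    nlinarith

lemma aux_sup (γ : ℝ → ℝ) (hγ : ContDiff ℝ 2 γ)
    (hper : ∀ x, γ (x + 2 * Real.pi) = γ x) (x : ℝ) :
    |deriv (deriv γ) x| ≤ ⨆ x, |deriv (deriv γ) x| := by
  have hp : ∀ f : ℝ → ℝ, Function.Periodic f (2 * Real.pi) →
      Function.Periodic (deriv f) (2 * Real.pi) := by
    intro f hf x
    rw [← deriv_comp_add_const]
    congr 1
    exact funext hf
  have h2 : Continuous (deriv (deriv γ)) := by
    have h := (contDiff_succ_iff_deriv (n := 1) (f := γ) (𝕜 := ℝ)).1 (by simpa [one_add_one_eq_two] using hγ)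
    exact h.2.2.continuous_deriv (by norm_num)
  have hb := (hp _ (hp γ hper)).isBounded_of_continuous (by positivity) h2
  obtain ⟨C, hC⟩ := hb.exists_norm_le
  refine le_ciSup (f := fun x => |deriv (deriv γ) x|) ⟨C, ?_⟩ x
  rintro _ ⟨y, rfl⟩
  exact hC _ ⟨y, rfl⟩

lemma aux_trig1 (x : ℝ) (hx : |x| ≤ Real.pi / 2) :
    |x + Real.sin x - Real.sin (2 * x)| ≤ 5 / 2 * x ^ 2 := by
  wlog h0 : 0 ≤ x
  · have := this (-x) (by rwa [abs_neg]) (by linarith)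
    rw [mul_neg, Real.sin_neg, Real.sin_neg, neg_sq] at this
    rw [← abs_neg]
    convert this using 2
    ring
  rw [abs_of_nonneg h0] at hx
  have h1 := Real.sin_le h0
  have h2 := Real.sin_le (x := 2 * x) (by linarith)
  have h3 := Real.sin_ge_sub_cube h0
  have h4 := Real.sin_ge_sub_cube (x := 2 * x) (by linarith)
  have h5 : x ≤ 1.575 := by linarith [Real.pi_lt_d2]
  have h6 : x ^ 3 ≤ 1.575 * x ^ 2 := by nlinarith [sq_nonneg x]
  rw [abs_le]; constructor <;> nlinarith [sq_nonneg x]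

lemma aux_trig2 (x : ℝ) (hx : |x| ≤ Real.pi / 2) :
    |3 * x - Real.sin x - Real.sin (2 * x)| ≤ 5 / 2 * x ^ 2 := by
  wlog h0 : 0 ≤ x
  · have := this (-x) (by rwa [abs_neg]) (by linarith)
    rw [mul_neg, mul_neg, Real.sin_neg, Real.sin_neg, neg_sq] at this
    rw [← abs_neg]
    convert this using 2
    ring
  rw [abs_of_nonneg h0] at hx
  have h1 := Real.sin_le h0
  have h2 := Real.sin_le (x := 2 * x) (by linarith)
  have h3 := Real.sin_ge_sub_cube h0
  have h4 := Real.sin_ge_sub_cube (x := 2 * x) (by linarith)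
  have h5 : x ≤ 1.575 := by linarith [Real.pi_lt_d2]
  have h6 : x ^ 3 ≤ 1.575 * x ^ 2 := by nlinarith [sq_nonneg x]
  rw [abs_le]; constructor <;> nlinarith [sq_nonneg x]

lemma aux_jordan (x B : ℝ) (hB : 0 ≤ B) (hx : |x| ≤ Real.pi / 2) :
    x ^ 2 / 2 * B ≤ Real.pi ^ 2 / 8 * B * Real.sin x ^ 2 := by
  have h := Real.mul_abs_le_abs_sin hx
  have h2 := pow_le_pow_left₀ (by positivity) h 2
  rw [mul_pow, sq_abs, sq_abs] at h2
  have h3 := mul_le_mul_of_nonneg_left h2 (show 0 ≤ Real.pi ^ 2 / 8 * B by positivity)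
  have e : Real.pi ^ 2 / 8 * B * ((2 / Real.pi) ^ 2 * x ^ 2) = x ^ 2 / 2 * B := by
    have := Real.pi_pos
    field_simp
    ring
  linarith

theorem stmt12 (γ : ℝ → ℝ) (hγ : ContDiff ℝ 2 γ)
    (hper : ∀ x, γ (x + 2 * Real.pi) = γ x) (hpos : ∀ x, 0 < γ x)
    (hstab : ∀ θ, 0 ≤ 3 * γ θ - γ (θ - Real.pi)) (φ θ : ℝ) :
    |Qfun γ φ θ| ≤ |Pfun γ (Afun γ θ) φ θ + γ θ| := by
  set M := ⨆ x, |deriv (deriv γ) x| with hMdef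
  have hM : ∀ x, |deriv (deriv γ) x| ≤ M := aux_sup γ hγ hper
  have hM0 : 0 ≤ M := (abs_nonneg _).trans (hM 0)
  have hT := aux_taylor γ hγ M hM θ
  have hP : Function.Periodic γ (2 * Real.pi) := hper
  have hg := hpos θ
  refine le_trans ?_ (le_abs_self _)
  have hAdef : Afun γ θ = Real.pi ^ 2 / 8 * (5 * M + 5 * |deriv γ θ| + γ θ) := rfl
  have hB : 0 ≤ 5 * M + 5 * |deriv γ θ| + γ θ := by positivity
  rw [abs_le]
  constructor
  · have hA : 9 / 2 * M ≤ Afun γ θ := by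
      rw [hAdef]
      have h3 := Real.pi_gt_three
      have h9 : 9 / 8 ≤ Real.pi ^ 2 / 8 := by nlinarith
      calc 9 / 2 * M ≤ 9 / 8 * (5 * M + 5 * |deriv γ θ| + γ θ) := by
            linarith [abs_nonneg (deriv γ θ)]
        _ ≤ _ := mul_le_mul_of_nonneg_right h9 hB
    unfold Qfun Pfun
    rw [Real.sin_two_mul]
    have hc1 := Real.neg_one_le_cos φ
    have hc2 := Real.cos_le_one φ
    set c := Real.cos φ
    set s := Real.sin φ
    have hq := hpos (θ - φ)
    have ht := (hpos _).le.trans (hT (-(s * ((2 * c + 1) / (2 + c)))))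
    have hc : 0 < 2 + c := by linarith
    have ht2 := mul_nonneg hc.le ht
    have e : (2 + c) * (γ θ + deriv γ θ * -(s * ((2 * c + 1) / (2 + c))) +
        M * (-(s * ((2 * c + 1) / (2 + c)))) ^ 2 / 2) =
        (2 + c) * γ θ - deriv γ θ * s * (2 * c + 1) +
          M * s ^ 2 * ((2 * c + 1) ^ 2 / (2 * (2 + c))) := by
      field_simp
      ring
    rw [e] at ht2
    have hk : (2 * c + 1) ^ 2 / (2 * (2 + c)) ≤ 9 / 2 := by
      rw [div_le_iff₀ (by linarith)]
      nlinarith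
    have hk2 := mul_le_mul_of_nonneg_left hk (show 0 ≤ M * s ^ 2 by positivity)
    have hk3 := mul_le_mul_of_nonneg_right hA (sq_nonneg s)
    nlinarith
  · obtain ⟨ψ, n, hψ, hφ⟩ : ∃ (ψ : ℝ) (n : ℤ), |ψ| ≤ Real.pi / 2 ∧ φ = ψ + n * Real.pi := by
      refine ⟨φ - round (φ / Real.pi) * Real.pi, round (φ / Real.pi), ?_, by ring⟩
      have h := abs_sub_round (φ / Real.pi)
      have e : φ - round (φ / Real.pi) * Real.pi =
          (φ / Real.pi - round (φ / Real.pi)) * Real.pi := by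
        field_simp
      rw [e, abs_mul, abs_of_pos Real.pi_pos]
      nlinarith [Real.pi_pos]
    have hJ := aux_jordan ψ _ hB hψ
    rw [← hAdef] at hJ
    have hcos := Real.one_sub_sq_div_two_le_cos (x := ψ)
    have hcg := mul_le_mul_of_nonneg_left hcos hg.le
    have hTψ := hT (-ψ)
    rw [← sub_eq_add_neg] at hTψ
    have hψ2 : 0 ≤ M * ψ ^ 2 := by positivity
    unfold Qfun Pfun
    rcases Int.even_or_odd' n with ⟨k, rfl | rfl⟩
    · have e : φ = ψ + k * (2 * Real.pi) := by rw [hφ]; push_cast; ring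
      have e1 : γ (θ - φ) = γ (θ - ψ) := by
        rw [e, ← sub_sub]; exact hP.sub_int_mul_eq k
      have e2 : Real.sin (2 * φ) = Real.sin (2 * ψ) := by
        rw [e, show 2 * (ψ + k * (2 * Real.pi)) = 2 * ψ + ((2 * k : ℤ) : ℝ) * (2 * Real.pi) by
          push_cast; ring, Real.sin_add_int_mul_two_pi]
      have e3 : Real.sin φ = Real.sin ψ := by rw [e, Real.sin_add_int_mul_two_pi]
      have e4 : Real.cos φ = Real.cos ψ := by rw [e, Real.cos_add_int_mul_two_pi]
      rw [e1, e2, e3, e4]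
      have hb := mul_le_mul_of_nonneg_left (aux_trig1 ψ hψ) (abs_nonneg (deriv γ θ))
      rw [← abs_mul] at hb
      have hb2 := neg_le_of_abs_le hb
      have hc2 := mul_le_mul_of_nonneg_left (Real.cos_le_one ψ) hg.le
      have hg2 : 0 ≤ γ θ * ψ ^ 2 := by positivity
      linarith
    · have e : φ = ψ + Real.pi + k * (2 * Real.pi) := by rw [hφ]; push_cast; ring
      have e1 : γ (θ - φ) = γ (θ - ψ - Real.pi) := by
        rw [e, ← sub_sub, ← sub_sub]; exact hP.sub_int_mul_eq k
      have e2 : Real.sin (2 * φ) = Real.sin (2 * ψ) := by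
        rw [e, show 2 * (ψ + Real.pi + k * (2 * Real.pi)) =
          2 * ψ + ((2 * k + 1 : ℤ) : ℝ) * (2 * Real.pi) by
          push_cast; ring, Real.sin_add_int_mul_two_pi]
      have e3 : Real.sin φ = -Real.sin ψ := by
        rw [e, Real.sin_add_int_mul_two_pi, Real.sin_add_pi]
      have e4 : Real.cos φ = -Real.cos ψ := by
        rw [e, Real.cos_add_int_mul_two_pi, Real.cos_add_pi]
      rw [e1, e2, e3, e4, neg_sq]
      have hs := hstab (θ - ψ)
      have hb := mul_le_mul_of_nonneg_left (aux_trig2 ψ hψ) (abs_nonneg (deriv γ θ))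
      rw [← abs_mul] at hb
      have hb2 := neg_le_of_abs_le hb
      linarith
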